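/- For d ≥ 2, μ > −1/2 and every n ≥ 0, the kernels of the classical ball moment functional u_μ satisfy K_n(u_μ; x, 0) = ( (μ+(d+1)/2)_{⌊n/2⌋} / (μ+1/2)_{⌊n/2⌋} ) · P_{⌊n/2⌋}^{(d/2, μ−1/2)}(1 − 2‖x‖²) for all x ∈ ℝ^d, and in particular K_n(u_μ; 0, 0) = ( (μ+(d+1)/2)_{⌊n/2⌋} / (μ+1/2)_{⌊n/2⌋} ) · C(⌊n/2⌋ + d/2, ⌊n/2⌋), where C(⌊n/2⌋+d/2, ⌊n/2⌋) = (d/2+1)_{⌊n/2⌋}/⌊n/2⌋! is the generalized binomial coefficient. -/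

import Mathlib

open MvPolynomial Matrix

/-- The index set for monomials of total degree `n` in `d` variables:
multi-indices (exponent tuples) summing to `n`. Its cardinality is `r_n^d = C(n+d-1,n)`. -/
abbrev Idx (d n : ℕ) : Type := {ν : Fin d → ℕ // ν ∈ Finset.Nat.antidiagonalTuple d n}

/-- The monomial `x^ν` associated with a multi-index `ν` of total degree `n`;
the family `fun α : Idx d n => monIdx α` is the canonical vector `𝕏_n`. -/
noncomputable def monIdx {d n : ℕ} (α : Idx d n) : MvPolynomial (Fin d) ℝ :=
  MvPolynomial.monomial (Finsupp.equivFunOnFinite.symm α.1) 1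

/-- A polynomial system (PS): a sequence of vectors `ℙ_n` of size `r_n^d` whose
entries are polynomials of total degree `n`, the entries of `ℙ_0,…,ℙ_n` forming a
basis of the polynomials of total degree at most `n`. -/
structure PolySystem (d : ℕ) where
  vec : (n : ℕ) → Idx d n → MvPolynomial (Fin d) ℝ
  degree_eq : ∀ n α, (vec n α).totalDegree = n
  indep : LinearIndependent ℝ (fun p : (Σ n : ℕ, Idx d n) => vec p.1 p.2)
  spans : ∀ (n : ℕ) (p : MvPolynomial (Fin d) ℝ), p.totalDegree ≤ n →
    p ∈ Submodule.span ℝ {q | ∃ m ≤ n, ∃ α : Idx d m, q = vec m α}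

/-- `{ℙ_n}` is an orthogonal polynomial system (OPS) with respect to the moment
functional `u` : `⟨u, 𝕏_m ℙ_n^t⟩ = 0` for `m < n` and `⟨u, 𝕏_n ℙ_n^t⟩` nonsingular. -/
def IsOPS {d : ℕ} (u : MvPolynomial (Fin d) ℝ →ₗ[ℝ] ℝ) (P : PolySystem d) : Prop :=
  (∀ m n : ℕ, m < n → ∀ (α : Idx d m) (β : Idx d n), u (monIdx α * P.vec n β) = 0) ∧
  (∀ n : ℕ, IsUnit (Matrix.of fun α β : Idx d n => u (monIdx α * P.vec n β)).det)

/-- `u` is quasi-definite iff it admits an OPS. -/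
def QuasiDefinite {d : ℕ} (u : MvPolynomial (Fin d) ℝ →ₗ[ℝ] ℝ) : Prop :=
  ∃ P : PolySystem d, IsOPS u P

/-- `H_n = ⟨u, ℙ_n ℙ_n^t⟩`. -/
noncomputable def Hmat {d : ℕ} (u : MvPolynomial (Fin d) ℝ →ₗ[ℝ] ℝ) (P : PolySystem d)
    (n : ℕ) : Matrix (Idx d n) (Idx d n) ℝ :=
  Matrix.of fun α β => u (P.vec n α * P.vec n β)

/-- `P_m(u;x,y) = ℙ_m(x)^t H_m⁻¹ ℙ_m(y)`. -/
noncomputable def kerP {d : ℕ} (u : MvPolynomial (Fin d) ℝ →ₗ[ℝ] ℝ) (P : PolySystem d)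
    (m : ℕ) (x y : Fin d → ℝ) : ℝ :=
  ∑ α, ∑ β, eval x (P.vec m α) * (Hmat u P m)⁻¹ α β * eval y (P.vec m β)

/-- `kerLT u P n = K_{n-1}(u;·,·) = Σ_{m<n} P_m(u;·,·)`, so that `kerLT u P 0 = K_{-1} = 0`. -/
noncomputable def kerLT {d : ℕ} (u : MvPolynomial (Fin d) ℝ →ₗ[ℝ] ℝ) (P : PolySystem d)
    (n : ℕ) (x y : Fin d → ℝ) : ℝ :=
  ∑ m ∈ Finset.range n, kerP u P m x y

/-- `𝖯_n(ξ) = (ℙ_n(ξ_1)|⋯|ℙ_n(ξ_N))`. -/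
noncomputable def Pmat {d N : ℕ} (P : PolySystem d) (ξ : Fin N → (Fin d → ℝ)) (n : ℕ) :
    Matrix (Idx d n) (Fin N) ℝ :=
  Matrix.of fun α i => eval (ξ i) (P.vec n α)

/-- `Kmat u P ξ n = 𝒦_{n-1} = (K_{n-1}(u;ξ_i,ξ_j))_{i,j}`, with `𝒦_{-1} = 0`. -/
noncomputable def Kmat {d N : ℕ} (u : MvPolynomial (Fin d) ℝ →ₗ[ℝ] ℝ) (P : PolySystem d)
    (ξ : Fin N → (Fin d → ℝ)) (n : ℕ) : Matrix (Fin N) (Fin N) ℝ :=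
  Matrix.of fun i j => kerLT u P n (ξ i) (ξ j)

/-- `Kvec u P ξ n x = 𝖪_{n-1}(ξ,x) = (K_{n-1}(u;ξ_1,x),…,K_{n-1}(u;ξ_N,x))^t`, with `𝖪_{-1}=0`. -/
noncomputable def Kvec {d N : ℕ} (u : MvPolynomial (Fin d) ℝ →ₗ[ℝ] ℝ) (P : PolySystem d)
    (ξ : Fin N → (Fin d → ℝ)) (n : ℕ) (x : Fin d → ℝ) : Fin N → ℝ :=
  fun i => kerLT u P n (ξ i) x

/-- A PS is monic if the degree-`n` homogeneous part of the entry of `ℙ_n` indexed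
by `α` is exactly the monomial `x^α`. -/
def PolySystem.IsMonic {d : ℕ} (P : PolySystem d) : Prop :=
  ∀ (n : ℕ) (α : Idx d n) (ν : Fin d →₀ ℕ), (ν.sum fun _ e => e) = n →
    MvPolynomial.coeff ν (P.vec n α) = if ν = Finsupp.equivFunOnFinite.symm α.1 then 1 else 0

/-- Multiplication of a real matrix times a vector of polynomials. -/
noncomputable def matVec {d : ℕ} {a b : Type} [Fintype b] (M : Matrix a b ℝ)
    (w : b → MvPolynomial (Fin d) ℝ) (i : a) : MvPolynomial (Fin d) ℝ :=
  ∑ j, M i j • w j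

/-- The matrix `L_{n,i}` determined by `x_i 𝕏_n = L_{n,i} 𝕏_{n+1}`. -/
noncomputable def Lmat (d n : ℕ) (i : Fin d) : Matrix (Idx d n) (Idx d (n + 1)) ℝ :=
  Matrix.of fun α β => if β.1 = (fun j => α.1 j + if j = i then 1 else 0) then 1 else 0

/-- The unique multi-index of degree 0. -/
def zeroIdx {d : ℕ} : Idx d 0 :=
  ⟨fun _ => 0, by simp [Finset.Nat.mem_antidiagonalTuple]⟩

/-- The degree-2 multi-index `e_i + e_j`. -/
def e2 {d : ℕ} (i j : Fin d) : Idx d 2 :=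
  ⟨fun k => (if k = i then 1 else 0) + (if k = j then 1 else 0), by
    simp [Finset.Nat.mem_antidiagonalTuple, Finset.sum_add_distrib]⟩

/-- `A_{h,2} = Σ_{1≤i≤j≤d} a^{(2)}_{ij} L_{h,j} L_{h+1,i}`. -/
noncomputable def Amat2 {d : ℕ} (a2 : Idx d 2 → ℝ) (h : ℕ) :
    Matrix (Idx d h) (Idx d (h + 2)) ℝ :=
  ∑ i : Fin d, ∑ j : Fin d,
    if i ≤ j then a2 (e2 i j) • (Lmat d h j * Lmat d (h + 1) i) else 0

/-- The polynomial `λ(x) = a_2·𝕏_2 + a_1·𝕏_1 + a_0`. -/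
noncomputable def lamPoly {d : ℕ} (a2 : Idx d 2 → ℝ) (a1 : Idx d 1 → ℝ) (a0 : ℝ) :
    MvPolynomial (Fin d) ℝ :=
  (∑ α : Idx d 2, a2 α • monIdx α) + (∑ α : Idx d 1, a1 α • monIdx α) + MvPolynomial.C a0

open MeasureTheory

/-- Generalized binomial coefficient `C(a,k) = a(a-1)⋯(a-k+1)/k!` for real `a`. -/
noncomputable def genBinom (a : ℝ) (k : ℕ) : ℝ :=
  (∏ j ∈ Finset.range k, (a - j)) / (Nat.factorial k)

/-- The Pochhammer symbol `(a)_m = a(a+1)⋯(a+m-1)`. -/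
noncomputable def poch (a : ℝ) (m : ℕ) : ℝ := (ascPochhammer ℝ m).eval a

/-- The classical Jacobi polynomial `P_n^{(α,β)}` (Szegő's normalization), as a
univariate real polynomial:
`P_n^{(α,β)}(t) = Σ_{s=0}^n C(n+α, n-s) C(n+β, s) ((t-1)/2)^s ((t+1)/2)^{n-s}`. -/
noncomputable def jacobiPoly (α β : ℝ) (n : ℕ) : Polynomial ℝ :=
  ∑ s ∈ Finset.range (n + 1),
    Polynomial.C (genBinom (n + α) (n - s) * genBinom (n + β) s * (1 / 2) ^ n) *
      (Polynomial.X - 1) ^ s * (Polynomial.X + 1) ^ (n - s)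

/-- Evaluation of the Jacobi polynomial at a real point. -/
noncomputable def jacobiP (α β : ℝ) (n : ℕ) (t : ℝ) : ℝ := (jacobiPoly α β n).eval t

/-- The normalizing constant `h_{j,n}(μ)` for the orthonormal ball polynomials. -/
noncomputable def hjn (d : ℕ) (μ : ℝ) (j n : ℕ) : ℝ :=
  Real.sqrt ((poch (μ + 1 / 2) j * poch ((d : ℝ) / 2) (n - j) *
      ((n : ℝ) - (j : ℝ) + μ + ((d : ℝ) - 1) / 2)) /
    ((Nat.factorial j : ℝ) * poch (μ + ((d : ℝ) + 1) / 2) (n - j) *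
      ((n : ℝ) + μ + ((d : ℝ) - 1) / 2)))

/-- The Laplace operator on polynomials, `Δ = Σ_i ∂²/∂x_i²`. -/
noncomputable def mvLaplacian (d : ℕ) :
    MvPolynomial (Fin d) ℝ →ₗ[ℝ] MvPolynomial (Fin d) ℝ :=
  ∑ i : Fin d, ((MvPolynomial.pderiv i).toLinearMap ∘ₗ (MvPolynomial.pderiv i).toLinearMap)

/-- `p` is a harmonic polynomial, homogeneous of degree `m`. -/
def IsHarmonicHomogeneous {d : ℕ} (p : MvPolynomial (Fin d) ℝ) (m : ℕ) : Prop :=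
  p.IsHomogeneous m ∧ mvLaplacian d p = 0

/-- `σ_m = dim ℋ_m^d`, the dimension of the space of harmonic polynomials in `d`
variables homogeneous of degree `m`. -/
noncomputable def sigmaH (d m : ℕ) : ℕ :=
  Module.finrank ℝ
    ↥((MvPolynomial.homogeneousSubmodule (Fin d) ℝ m) ⊓ LinearMap.ker (mvLaplacian d))

/-- The closed unit ball in `ℝ^d`. -/
def ballSet (d : ℕ) : Set (Fin d → ℝ) := {x | ∑ i, x i ^ 2 ≤ 1}

/-- The normalizing constant `ω_μ = Γ(μ+(d+1)/2)/(π^{d/2}Γ(μ+1/2))`. -/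
noncomputable def omegaMu (d : ℕ) (μ : ℝ) : ℝ :=
  Real.Gamma (μ + ((d : ℝ) + 1) / 2) /
    (Real.pi ^ ((d : ℝ) / 2) * Real.Gamma (μ + 1 / 2))

/-- `u` is the classical ball moment functional
`⟨u_μ, p⟩ = ω_μ ∫_{𝔹^d} p(x)(1-‖x‖²)^{μ-1/2} dx`. -/
def IsBallFunctional (d : ℕ) (μ : ℝ) (u : MvPolynomial (Fin d) ℝ →ₗ[ℝ] ℝ) : Prop :=
  ∀ p : MvPolynomial (Fin d) ℝ,
    u p = omegaMu d μ *
      ∫ x in ballSet d, (eval x p) * (1 - ∑ i, x i ^ 2) ^ (μ - 1 / 2 : ℝ)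

/-- The orthonormal ball polynomial
`P^n_{j,·}(x;μ) = h_{j,n}(μ)⁻¹ P_j^{(μ-1/2,n-2j+(d-2)/2)}(2‖x‖²-1) Y(x)`,
evaluated at `x`, for a harmonic polynomial `Y` homogeneous of degree `n-2j`. -/
noncomputable def ballPval (d : ℕ) (μ : ℝ) (n j : ℕ) (Y : MvPolynomial (Fin d) ℝ)
    (x : Fin d → ℝ) : ℝ :=
  (hjn d μ j n)⁻¹ *
    jacobiP (μ - 1 / 2) ((n : ℝ) - 2 * (j : ℝ) + ((d : ℝ) - 2) / 2) j
      (2 * (∑ i, x i ^ 2) - 1) * eval x Y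

lemma poch_zero (a : ℝ) : poch a 0 = 1 := by simp [poch]

lemma poch_succ (a : ℝ) (n : ℕ) : poch a (n + 1) = poch a n * (a + n) := by
  simp [poch, ascPochhammer_succ_eval]

lemma poch_succ_left (a : ℝ) (n : ℕ) : poch a (n + 1) = a * poch (a + 1) n := by
  simp [poch, ascPochhammer_succ_left]

lemma poch_add (a : ℝ) (m n : ℕ) : poch a (m + n) = poch a m * poch (a + m) n := by
  induction n with
  | zero => simp [poch_zero]
  | succ n ih => rw [← add_assoc, poch_succ, poch_succ, ih]; push_cast; ring

lemma poch_pos {a : ℝ} (ha : 0 < a) (n : ℕ) : 0 < poch a n := ascPochhammer_pos n a ha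

lemma poch_one (n : ℕ) : poch 1 n = Nat.factorial n := by
  simp [poch, ascPochhammer_eval_one]

/-- The Pochhammer symbol `(1 - m)_k` vanishes for `1 ≤ m ≤ k`. -/
lemma poch_one_sub_eq_zero {m k : ℕ} (hm : 1 ≤ m) (hmk : m ≤ k) : poch (1 - m) k = 0 := by
  obtain ⟨j, rfl⟩ := Nat.exists_eq_add_of_le hm
  obtain ⟨i, rfl⟩ := Nat.exists_eq_add_of_le hmk
  rw [show 1 + j + i = j + 1 + i by ring, poch_add, poch_succ]
  push_cast
  ring

lemma Gamma_add_nat_eq_mul_poch {a : ℝ} (ha : 0 < a) (n : ℕ) :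
    Real.Gamma (a + n) = Real.Gamma a * poch a n := by
  induction n with
  | zero => simp [poch_zero]
  | succ n ih =>
    push_cast
    rw [← add_assoc, Real.Gamma_add_one (by positivity), ih, poch_succ]
    ring

lemma genBinom_add_nat (a : ℝ) (k : ℕ) :
    genBinom (a + k) k = poch (a + 1) k / Nat.factorial k := by
  rw [genBinom]
  congr 1
  induction k generalizing a with
  | zero => simp [poch_zero]
  | succ k ih =>
    rw [Finset.prod_range_succ, poch_succ_left, ← ih (a + 1), mul_comm]
    push_cast
    congr 1
    · ring
    · exact Finset.prod_congr rfl fun j _ => by ring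

/-- An alternating form of the Chu–Vandermonde identity. -/
lemma sum_neg_one_pow_choose_poch (a c : ℝ) (k : ℕ) :
    ∑ s ∈ Finset.range (k + 1),
      (-1) ^ s * (k.choose s : ℝ) * poch a s * poch (c + s) (k - s) = poch (c - a) k := by
  induction k generalizing a c with
  | zero => simp [poch_zero]
  | succ k ih =>
    rw [Finset.sum_range_succ']
    have hterm : ∀ s ∈ Finset.range (k + 1),
        (-1 : ℝ) ^ (s + 1) * ((k + 1).choose (s + 1) : ℝ) * poch a (s + 1) *
          poch (c + (s + 1 : ℕ)) (k + 1 - (s + 1)) =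
        -a * ((-1) ^ s * (k.choose s : ℝ) * poch (a + 1) s * poch (c + 1 + s) (k - s)) +
        (-1 : ℝ) ^ (s + 1) * (k.choose (s + 1) : ℝ) * poch a (s + 1) *
          poch (c + (s + 1 : ℕ)) (k - s) := by
      intro s _
      rw [Nat.choose_succ_succ, Nat.add_sub_add_right, poch_succ_left a]
      push_cast
      rw [show c + ((s : ℝ) + 1) = c + 1 + s by ring]
      ring
    rw [Finset.sum_congr rfl hterm, Finset.sum_add_distrib, ← Finset.mul_sum, ih, add_assoc]
    have hzero :
        (-1 : ℝ) ^ 0 * ((k + 1).choose 0 : ℝ) * poch a 0 * poch (c + (0 : ℕ)) (k + 1 - 0) =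
        (-1 : ℝ) ^ 0 * (k.choose 0 : ℝ) * poch a 0 * poch (c + (0 : ℕ)) (k + 1 - 0) := by simp
    rw [hzero]
    have hsplit := Finset.sum_range_succ' (fun s : ℕ =>
      (-1 : ℝ) ^ s * (k.choose s : ℝ) * poch a s * poch (c + s) (k + 1 - s)) (k + 1)
    simp only [Nat.add_sub_add_right] at hsplit
    rw [← hsplit, Finset.sum_range_succ, Nat.choose_succ_self]
    have hfac : ∀ s ∈ Finset.range (k + 1),
        (-1 : ℝ) ^ s * (k.choose s : ℝ) * poch a s * poch (c + s) (k + 1 - s) =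
        (c + k) * ((-1 : ℝ) ^ s * (k.choose s : ℝ) * poch a s * poch (c + s) (k - s)) := by
      intro s hs
      have hsk : s ≤ k := Nat.lt_succ_iff.mp (Finset.mem_range.mp hs)
      rw [Nat.sub_add_comm hsk, poch_succ, Nat.cast_sub hsk]
      ring
    rw [Finset.sum_congr rfl hfac, ← Finset.mul_sum, ih, poch_succ (c - a)]
    rw [show c + 1 - (a + 1) = c - a by ring]
    push_cast
    ring

lemma jacobiP_one_sub_two_mul (α β : ℝ) (n : ℕ) (t : ℝ) :
    jacobiP α β n (1 - 2 * t) = ∑ s ∈ Finset.range (n + 1),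
      genBinom (n + α) (n - s) * genBinom (n + β) s * (-1) ^ s * (t ^ s * (1 - t) ^ (n - s)) := by
  rw [jacobiP, jacobiPoly, Polynomial.eval_finsetSum]
  refine Finset.sum_congr rfl fun s hs => ?_
  have hsn : s ≤ n := Nat.lt_succ_iff.mp (Finset.mem_range.mp hs)
  simp only [Polynomial.eval_mul, Polynomial.eval_C, Polynomial.eval_pow, Polynomial.eval_sub,
    Polynomial.eval_add, Polynomial.eval_X, Polynomial.eval_one]
  have h1 : (1 - 2 * t - 1) ^ s = (-1) ^ s * 2 ^ s * t ^ s := by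
    rw [← mul_pow, ← mul_pow]; congr 1; ring
  have h2 : (1 - 2 * t + 1) ^ (n - s) = 2 ^ (n - s) * (1 - t) ^ (n - s) := by
    rw [← mul_pow]; congr 1; ring
  have h3 : (2 : ℝ) ^ s * 2 ^ (n - s) * (1 / 2) ^ n = 1 := by
    rw [← pow_add, Nat.add_sub_cancel' hsn, ← mul_pow]; norm_num
  rw [h1, h2]
  linear_combination (genBinom (n + α) (n - s) * genBinom (n + β) s * (-1) ^ s *
    (t ^ s * (1 - t) ^ (n - s))) * h3

lemma jacobiP_one (α β : ℝ) (n : ℕ) :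
    jacobiP α β n 1 = poch (α + 1) n / Nat.factorial n := by
  have h := jacobiP_one_sub_two_mul α β n 0
  rw [mul_zero, sub_zero] at h
  rw [h, Finset.sum_range_succ', Finset.sum_eq_zero fun s _ => by simp]
  have h0 : genBinom (n + β) 0 = 1 := by simp [genBinom]
  simp [h0, add_comm (n : ℝ) α, genBinom_add_nat]

/-- The integral of `t ^ (α + m - 1) * (1 - t) ^ β` against the Jacobi polynomial
`P_k^{(α,β)}(1 - 2t)`, with each Beta integral written in terms of Gamma values. -/
lemma sum_jacobi_coeff_mul_Gamma {α β : ℝ} (hα : 0 < α) (hβ : 0 < β + 1) (m k : ℕ) :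
    ∑ s ∈ Finset.range (k + 1), genBinom (k + α) (k - s) * genBinom (k + β) s * (-1) ^ s *
      (Real.Gamma (α + m + s) * Real.Gamma (β + 1 + (k - s : ℕ)) /
        Real.Gamma (α + m + s + (β + 1 + (k - s : ℕ)))) =
    poch (β + 1) k / Nat.factorial k * poch (1 - m) k *
      (Real.Gamma (α + m) * Real.Gamma (β + 1) / Real.Gamma (α + m + (β + 1) + k)) := by
  rw [show (1 : ℝ) - m = α + 1 - (α + m) by ring, ← sum_neg_one_pow_choose_poch, Finset.mul_sum,
    Finset.sum_mul]
  refine Finset.sum_congr rfl fun s hs => ?_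
  have hsk : s ≤ k := Nat.lt_succ_iff.mp (Finset.mem_range.mp hs)
  obtain ⟨j, rfl⟩ := Nat.exists_eq_add_of_le hsk
  have h1 : genBinom ((s + j : ℕ) + α) (s + j - s) = poch (α + 1 + s) j / Nat.factorial j := by
    have := genBinom_add_nat (α + s) j
    rw [Nat.add_sub_cancel_left]
    push_cast
    convert this using 2 <;> ring_nf
  have h2 : genBinom ((s + j : ℕ) + β) s = poch (β + 1 + j) s / Nat.factorial s := by
    have := genBinom_add_nat (β + j) s
    push_cast
    convert this using 2 <;> ring_nf
  rw [h1, h2, Nat.add_sub_cancel_left, Gamma_add_nat_eq_mul_poch (by positivity),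
    Gamma_add_nat_eq_mul_poch hβ, add_comm s j, poch_add (β + 1) j s,
    ← Nat.add_choose_mul_factorial_mul_factorial j s,
    Nat.add_comm j s, Nat.choose_symm_add]
  have hc : ((s + j).choose j : ℝ) ≠ 0 := by
    exact_mod_cast (Nat.choose_pos (by omega)).ne'
  have hG : α + m + s + (β + 1 + j) = α + m + (β + 1) + (s + j : ℕ) := by push_cast; ring
  rw [hG]
  push_cast
  field_simp

section Kernel

variable {d : ℕ} {u : MvPolynomial (Fin d) ℝ →ₗ[ℝ] ℝ} {P : PolySystem d}

lemma totalDegree_le_induction {n : ℕ} {motive : MvPolynomial (Fin d) ℝ → Prop}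
    (hmon : ∀ m ≤ n, ∀ α : Idx d m, motive (monIdx α))
    (hzero : motive 0) (hadd : ∀ p q, motive p → motive q → motive (p + q))
    (hsmul : ∀ (c : ℝ) p, motive p → motive (c • p))
    (p : MvPolynomial (Fin d) ℝ) (hp : p.totalDegree ≤ n) : motive p := by
  rw [p.as_sum]
  refine Finset.sum_induction _ motive hadd hzero fun ν hν => ?_
  have hle : ∑ i, ν i ≤ n := by
    refine le_trans (le_of_eq ?_) ((le_totalDegree hν).trans hp)
    simp [Finsupp.sum_fintype]
  have h := hsmul (coeff ν p) _
    (hmon _ hle ⟨ν, Finset.Nat.mem_antidiagonalTuple.mpr rfl⟩)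
  simpa [monIdx, smul_monomial] using h

lemma IsOPS.apply_mul_vec_eq_zero (hP : IsOPS u P) {m n : ℕ} (hmn : m < n)
    {p : MvPolynomial (Fin d) ℝ} (hp : p.totalDegree ≤ m) (β : Idx d n) :
    u (p * P.vec n β) = 0 :=
  totalDegree_le_induction (motive := fun p => u (p * P.vec n β) = 0)
    (fun k hk α => hP.1 k n (hk.trans_lt hmn) α β) (by simp)
    (fun p q hp hq => by rw [add_mul, map_add, hp, hq, add_zero])
    (fun c p hp => by rw [smul_mul_assoc, map_smul, hp, smul_zero]) p hp

lemma IsOPS.apply_vec_mul_vec_eq_zero (hP : IsOPS u P) {m n : ℕ} (hmn : m ≠ n)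
    (α : Idx d m) (β : Idx d n) : u (P.vec m α * P.vec n β) = 0 := by
  rcases hmn.lt_or_gt with h | h
  · exact hP.apply_mul_vec_eq_zero h (P.degree_eq m α).le β
  · rw [mul_comm]
    exact hP.apply_mul_vec_eq_zero h (P.degree_eq n β).le α

lemma Hmat_transpose (n : ℕ) : (Hmat u P n)ᵀ = Hmat u P n := by
  ext α β
  simp [Hmat, mul_comm]

lemma IsOPS.isUnit_det_Hmat (hP : IsOPS u P) (n : ℕ) : IsUnit (Hmat u P n).det := by
  rw [isUnit_iff_ne_zero]
  intro hdet
  obtain ⟨c, hc0, hc⟩ := Matrix.exists_mulVec_eq_zero_iff.mpr hdet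
  have hr : ∀ p ∈ Submodule.span ℝ {q | ∃ m ≤ n, ∃ α : Idx d m, q = P.vec m α},
      u (p * ∑ β, c β • P.vec n β) = 0 := by
    intro p hp
    induction hp using Submodule.span_induction with
    | mem p hp =>
      obtain ⟨m, hm, α, rfl⟩ := hp
      rcases hm.lt_or_eq with h | rfl
      · simp [Finset.mul_sum, hP.apply_vec_mul_vec_eq_zero h.ne]
      · have := congrFun hc α
        simpa [Matrix.mulVec, dotProduct, Hmat, Finset.mul_sum, mul_smul_comm, mul_comm] using this
    | zero => simp
    | add p q _ _ hp hq => rw [add_mul, map_add, hp, hq, add_zero]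
    | smul a p _ hp => rw [smul_mul_assoc, map_smul, hp, smul_zero]
  refine (hP.2 n).ne_zero (Matrix.exists_mulVec_eq_zero_iff.mp ⟨c, hc0, ?_⟩)
  ext α
  have hdeg : (monIdx α).totalDegree ≤ n := by
    refine (totalDegree_monomial_le _ _).trans (le_of_eq ?_)
    simpa [Finsupp.sum_fintype] using Finset.Nat.mem_antidiagonalTuple.mp α.2
  have := hr _ (P.spans n _ hdeg)
  simpa [Matrix.mulVec, dotProduct, Finset.mul_sum, mul_smul_comm, mul_comm] using this

lemma PolySystem.exists_eq_sum (P : PolySystem d) {n : ℕ} {q : MvPolynomial (Fin d) ℝ}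
    (hq : q.totalDegree ≤ n) :
    ∃ c : (m : ℕ) → Idx d m → ℝ, q = ∑ m ∈ Finset.range (n + 1), ∑ α, c m α • P.vec m α := by
  classical
  have hspan := P.spans n q hq
  clear hq
  induction hspan using Submodule.span_induction with
  | mem p hp =>
    obtain ⟨m, hm, α, rfl⟩ := hp
    refine ⟨fun k β => if h : k = m then (if h ▸ β = α then 1 else 0) else 0, ?_⟩
    rw [Finset.sum_eq_single_of_mem m (Finset.mem_range.mpr (Nat.lt_succ_of_le hm))]
    · simp
    · intro k _ hk
      simp [hk]
  | zero => exact ⟨0, by simp⟩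
  | add p q _ _ hp hq =>
    obtain ⟨a, ha⟩ := hp
    obtain ⟨b, hb⟩ := hq
    exact ⟨a + b, by simp [ha, hb, add_smul, Finset.sum_add_distrib]⟩
  | smul a p _ hp =>
    obtain ⟨b, hb⟩ := hp
    exact ⟨a • b, by simp [hb, mul_smul, Finset.smul_sum]⟩

/-- The kernel `K_n(u; ·, y)` is the only polynomial of degree at most `n` that reproduces
the evaluation at `y` on polynomials of degree at most `n`. -/
lemma IsOPS.kerLT_eq_eval (hP : IsOPS u P) {n : ℕ} {q : MvPolynomial (Fin d) ℝ} {y : Fin d → ℝ}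
    (hq : q.totalDegree ≤ n)
    (hrep : ∀ p : MvPolynomial (Fin d) ℝ, p.totalDegree ≤ n → u (q * p) = eval y p)
    (x : Fin d → ℝ) : kerLT u P (n + 1) x y = eval x q := by
  obtain ⟨c, hc⟩ := P.exists_eq_sum hq
  have hH : ∀ m ∈ Finset.range (n + 1), Hmat u P m *ᵥ c m = fun β => eval y (P.vec m β) := by
    intro m hm
    ext β
    rw [← hrep _ ((P.degree_eq m β).le.trans (Nat.lt_succ_iff.mp (Finset.mem_range.mp hm))), hc,
      Finset.sum_mul, map_sum, Finset.sum_eq_single_of_mem m hm]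
    · simp only [Matrix.mulVec, dotProduct]
      rw [Finset.sum_mul, map_sum]
      refine Finset.sum_congr rfl fun α _ => ?_
      rw [smul_mul_assoc, map_smul, smul_eq_mul, mul_comm (P.vec m α), Hmat, Matrix.of_apply,
        mul_comm (c m α)]
    · intro k _ hk
      simp [Finset.sum_mul, hP.apply_vec_mul_vec_eq_zero hk]
  conv_rhs => rw [hc, map_sum]
  refine Finset.sum_congr rfl fun m hm => ?_
  have hcm : c m = (Hmat u P m)⁻¹ *ᵥ fun β => eval y (P.vec m β) := by
    rw [← hH m hm, Matrix.mulVec_mulVec, Matrix.nonsing_inv_mul _ (hP.isUnit_det_Hmat m),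
      Matrix.one_mulVec]
  rw [kerP, map_sum]
  refine Finset.sum_congr rfl fun α _ => ?_
  rw [smul_eval, hcm, Matrix.mulVec, dotProduct, Finset.sum_mul]
  exact Finset.sum_congr rfl fun β _ => by ring

end Kernel

lemma IsHomogeneous_eval_smul {σ : Type*} {p : MvPolynomial σ ℝ} {n : ℕ}
    (hp : p.IsHomogeneous n) (r : ℝ) (x : σ → ℝ) : eval (r • x) p = r ^ n * eval x p := by
  rw [eval_eq, eval_eq, Finset.mul_sum]
  refine Finset.sum_congr rfl fun ν hν => ?_
  have hdeg : ∑ i ∈ ν.support, ν i = n := by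
    simpa [Finsupp.weight_apply, Finsupp.sum] using hp (mem_support_iff.mp hν)
  simp only [Pi.smul_apply, smul_eq_mul, mul_pow, Finset.prod_mul_distrib]
  rw [Finset.prod_pow_eq_pow_sum, hdeg]
  ring

/-- Integration in polar coordinates of a positively homogeneous function times a radial one. -/
lemma integral_homogeneous_mul_fun_norm {E : Type*} [NormedAddCommGroup E] [NormedSpace ℝ E]
    [MeasurableSpace E] [Nontrivial E] (ρ : Measure E) [FiniteDimensional ℝ E] [BorelSpace E]
    [ρ.IsAddHaarMeasure] {Y : E → ℝ} {j : ℕ}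
    (hY : ∀ r : ℝ, ∀ x, Y (r • x) = r ^ j * Y x) (g : ℝ → ℝ) :
    ∫ x, Y x * g ‖x‖ ∂ρ = (∫ θ : Metric.sphere (0 : E) 1, Y θ ∂ρ.toSphere) *
      ∫ r in Set.Ioi (0 : ℝ), r ^ (Module.finrank ℝ E - 1) * (r ^ j * g r) :=
  calc
    ∫ x, Y x * g ‖x‖ ∂ρ
      = ∫ x : ({(0)}ᶜ : Set E), Y x.1 * g ‖x.1‖ ∂(ρ.comap (↑)) := by
      rw [integral_subtype_comap (measurableSet_singleton _).compl fun x ↦ Y x * g ‖x‖,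
        restrict_compl_singleton]
    _ = ∫ z : Metric.sphere (0 : E) 1 × Set.Ioi (0 : ℝ), Y z.1 * (z.2.1 ^ j * g z.2.1)
          ∂ρ.toSphere.prod (.volumeIoiPow (Module.finrank ℝ E - 1)) := by
      rw [← ρ.measurePreserving_homeomorphUnitSphereProd.integral_comp
        (Homeomorph.measurableEmbedding _)]
      refine integral_congr_ae (.of_forall fun x => ?_)
      have hx : ‖x.1‖ ≠ 0 := norm_ne_zero_iff.mpr x.2
      simp only [homeomorphUnitSphereProd_apply_fst_coe, homeomorphUnitSphereProd_apply_snd_coe, hY]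
      have hc : ‖x.1‖⁻¹ ^ j * ‖x.1‖ ^ j = 1 := by
        rw [← mul_pow, inv_mul_cancel₀ hx, one_pow]
      linear_combination -(Y x.1 * g ‖x.1‖) * hc
    _ = (∫ θ : Metric.sphere (0 : E) 1, Y θ ∂ρ.toSphere) *
          ∫ r : Set.Ioi (0 : ℝ), r.1 ^ j * g r.1 ∂.volumeIoiPow (Module.finrank ℝ E - 1) :=
      integral_prod_mul (fun θ : Metric.sphere (0 : E) 1 => Y θ)
        fun r : Set.Ioi (0 : ℝ) => r.1 ^ j * g r.1
    _ = _ := by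
      congr 1
      simp only [Measure.volumeIoiPow, ENNReal.ofReal]
      rw [integral_withDensity_eq_integral_smul,
        integral_subtype_comap measurableSet_Ioi fun a : ℝ ↦
          Real.toNNReal (a ^ (Module.finrank ℝ E - 1)) • (a ^ j * g a),
        setIntegral_congr_fun measurableSet_Ioi fun x hx ↦ ?_]
      · rw [NNReal.smul_def, Real.coe_toNNReal _ (pow_nonneg (le_of_lt hx) _), smul_eq_mul]
      · exact (measurable_subtype_coe.pow_const _).real_toNNReal

/-- Half the integral of a polynomial over the Euclidean unit sphere. -/
noncomputable def halfSphereIntegral {d : ℕ} (p : MvPolynomial (Fin d) ℝ) : ℝ :=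
  1 / 2 * ∫ θ : Metric.sphere (0 : EuclideanSpace ℝ (Fin d)) 1,
    eval (WithLp.ofLp θ.1) p ∂(volume : Measure (EuclideanSpace ℝ (Fin d))).toSphere

lemma halfSphereIntegral_one {d : ℕ} (hd : d ≠ 0) :
    halfSphereIntegral (1 : MvPolynomial (Fin d) ℝ) =
      Real.pi ^ ((d : ℝ) / 2) / Real.Gamma ((d : ℝ) / 2) := by
  have : NeZero d := ⟨hd⟩
  have hd' : (d : ℝ) ≠ 0 := Nat.cast_ne_zero.mpr hd
  have hpi : √Real.pi ^ d = Real.pi ^ ((d : ℝ) / 2) := by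
    rw [Real.sqrt_eq_rpow, ← Real.rpow_natCast, ← Real.rpow_mul Real.pi_pos.le]
    congr 1
    ring
  have hvol : (volume : Measure (EuclideanSpace ℝ (Fin d))).real (Metric.ball 0 1) =
      Real.pi ^ ((d : ℝ) / 2) / Real.Gamma ((d : ℝ) / 2 + 1) := by
    rw [measureReal_def, EuclideanSpace.volume_ball]
    simp only [ENNReal.ofReal_one, one_pow, one_mul, Fintype.card_fin, hpi]
    exact ENNReal.toReal_ofReal (div_nonneg (by positivity)
      (Real.Gamma_nonneg_of_nonneg (by positivity)))
  simp only [halfSphereIntegral, map_one, integral_const, smul_eq_mul, mul_one,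
    Measure.toSphere_real_apply_univ, finrank_euclideanSpace, Fintype.card_fin, hvol]
  rw [Real.Gamma_add_one (by positivity)]
  have := (Real.Gamma_pos_of_pos (s := (d : ℝ) / 2) (by positivity)).ne'
  field_simp

lemma measurableSet_ballSet (d : ℕ) : MeasurableSet (ballSet d) :=
  measurableSet_le (by fun_prop) measurable_const

lemma setIntegral_ballSet_homogeneous {d : ℕ} (hd : d ≠ 0) {p : MvPolynomial (Fin d) ℝ} {j : ℕ}
    (hp : p.IsHomogeneous j) (G : ℝ → ℝ) :
    ∫ x in ballSet d, eval x p * G (∑ i, x i ^ 2) =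
      halfSphereIntegral p *
        ∫ t in Set.Ioo (0 : ℝ) 1, t ^ (((d : ℝ) + j) / 2 - 1) * G t := by
  have : NeZero d := ⟨hd⟩
  have hpolar := integral_homogeneous_mul_fun_norm
    (volume : Measure (EuclideanSpace ℝ (Fin d)))
    (Y := fun x => eval (WithLp.ofLp x) p) (j := j)
    (fun r x => by simpa using IsHomogeneous_eval_smul hp r (WithLp.ofLp x))
    (fun r => (Set.Iic (1 : ℝ)).indicator G (r ^ 2))
  have hind : ∀ x : Fin d → ℝ, (ballSet d).indicator (fun x => eval x p * G (∑ i, x i ^ 2)) x =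
      eval x p * (Set.Iic (1 : ℝ)).indicator G (‖WithLp.toLp 2 x‖ ^ 2) := by
    intro x
    simp [Set.indicator_apply, ballSet, EuclideanSpace.norm_sq_eq]
  rw [← integral_indicator (measurableSet_ballSet d), integral_congr_ae (.of_forall hind),
    ← (PiLp.volume_preserving_ofLp (Fin d)).integral_comp
      (MeasurableEquiv.toLp 2 (Fin d → ℝ)).symm.measurableEmbedding]
  simp only [WithLp.toLp_ofLp]
  rw [hpolar, halfSphereIntegral, mul_comm (1 / 2 : ℝ), mul_assoc]
  congr 1
  have hsub := integral_comp_rpow_Ioi_of_pos (p := 2)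
    (g := fun t : ℝ => (Set.Iic (1 : ℝ)).indicator (fun t => t ^ (((d : ℝ) + j) / 2 - 1) * G t) t)
    two_pos
  rw [setIntegral_indicator measurableSet_Iic, Set.Ioi_inter_Iic, integral_Ioc_eq_integral_Ioo]
    at hsub
  rw [← hsub, ← integral_const_mul]
  refine setIntegral_congr_fun measurableSet_Ioi fun r hr => ?_
  have hr0 : (0 : ℝ) < r := hr
  have hpow : r * (r ^ 2) ^ (((d : ℝ) + j) / 2 - 1) = r ^ (d - 1) * r ^ j := by
    nth_rewrite 1 [← Real.rpow_one r]
    rw [← Real.rpow_natCast r 2, ← Real.rpow_mul hr0.le, ← pow_add,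
      ← Real.rpow_natCast r (d - 1 + j), ← Real.rpow_add hr0]
    congr 1
    push_cast [Nat.cast_sub (Nat.one_le_iff_ne_zero.mpr hd)]
    ring
  have h2 : r ^ (2 : ℝ) = r ^ 2 := by exact_mod_cast Real.rpow_natCast r 2
  simp only [finrank_euclideanSpace, Fintype.card_fin, Set.indicator_apply, h2, smul_eq_mul]
  norm_num
  split_ifs
  · linear_combination -G (r ^ 2) * hpow
  · rfl

lemma integral_Ioo_rpow_mul_one_sub_rpow {a b : ℝ} (ha : 0 < a) (hb : 0 < b) :
    ∫ t in Set.Ioo (0 : ℝ) 1, t ^ (a - 1) * (1 - t) ^ (b - 1) =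
      Real.Gamma a * Real.Gamma b / Real.Gamma (a + b) := by
  change _ = ProbabilityTheory.beta a b
  rw [ProbabilityTheory.beta_eq_betaIntegralReal a b ha hb, Complex.betaIntegral,
    intervalIntegral.integral_of_le (by norm_num), ← integral_Ioc_eq_integral_Ioo,
    ← RCLike.re_to_complex, ← integral_re]
  · refine setIntegral_congr_fun measurableSet_Ioc fun x ⟨hx1, hx2⟩ ↦ ?_
    norm_cast
    rw [← Complex.ofReal_cpow, ← Complex.ofReal_cpow, RCLike.re_to_complex,
      Complex.re_mul_ofReal, Complex.ofReal_re]
    all_goals linarith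
  · convert! Complex.betaIntegral_convergent (u := a) (v := b) (by simpa) (by simpa)
    rw [intervalIntegrable_iff_integrableOn_Ioc_of_le (by simp), IntegrableOn]

/-- The squared Euclidean norm as a polynomial. -/
noncomputable def normSqPoly (d : ℕ) : MvPolynomial (Fin d) ℝ := ∑ i, X i ^ 2

lemma eval_normSqPoly {d : ℕ} (x : Fin d → ℝ) : eval x (normSqPoly d) = ∑ i, x i ^ 2 := by
  simp [normSqPoly]

lemma totalDegree_normSqPoly_le (d : ℕ) : (normSqPoly d).totalDegree ≤ 2 :=
  totalDegree_finsetSum_le fun i _ => by simp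

lemma IsBallFunctional.apply_radial_mul_homogeneous {d : ℕ} (hd : d ≠ 0) {μ : ℝ}
    (hμ : -(1 / 2) < μ) {u : MvPolynomial (Fin d) ℝ →ₗ[ℝ] ℝ} (hu : IsBallFunctional d μ u)
    {p : MvPolynomial (Fin d) ℝ} {m : ℕ} (hp : p.IsHomogeneous (2 * m)) (s l : ℕ) :
    u (normSqPoly d ^ s * (1 - normSqPoly d) ^ l * p) =
      omegaMu d μ * halfSphereIntegral p *
        (Real.Gamma ((d : ℝ) / 2 + m + s) * Real.Gamma (μ - 1 / 2 + 1 + l) /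
          Real.Gamma ((d : ℝ) / 2 + m + s + (μ - 1 / 2 + 1 + l))) := by
  have hd0 : (0 : ℝ) < d := by positivity
  have hb : 0 < μ - 1 / 2 + 1 + l := by
    have : (0 : ℝ) ≤ l := by positivity
    linarith
  have hG := setIntegral_ballSet_homogeneous hd hp
    fun t => t ^ s * (1 - t) ^ l * (1 - t) ^ (μ - 1 / 2)
  rw [hu, mul_assoc (omegaMu d μ), ← integral_Ioo_rpow_mul_one_sub_rpow (by positivity) hb]
  congr 1
  calc _ = _ := by
        refine setIntegral_congr_fun (measurableSet_ballSet d) fun x _ => ?_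
        simp only [map_mul, map_pow, map_sub, map_one, eval_normSqPoly]
        ring
    _ = _ := hG
    _ = _ := by
        congr 1
        refine setIntegral_congr_fun measurableSet_Ioo fun t ht => ?_
        have ht1 : 0 < 1 - t := sub_pos.mpr ht.2
        have e1 : t ^ ((d : ℝ) / 2 + m + s - 1) = t ^ (((d : ℝ) + (2 * m : ℕ)) / 2 - 1) * t ^ s := by
          rw [← Real.rpow_natCast t s, ← Real.rpow_add ht.1]
          congr 1
          push_cast
          ring
        have e2 : (1 - t) ^ (μ - 1 / 2 + 1 + l - 1) = (1 - t) ^ (μ - 1 / 2) * (1 - t) ^ l := by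
          rw [← Real.rpow_natCast (1 - t) l, ← Real.rpow_add ht1]
          congr 1
          ring
        simp only [e1, e2]
        ring

lemma IsBallFunctional.apply_eq_zero_of_odd {d : ℕ} {μ : ℝ}
    {u : MvPolynomial (Fin d) ℝ →ₗ[ℝ] ℝ} (hu : IsBallFunctional d μ u)
    {p : MvPolynomial (Fin d) ℝ} (hp : ∀ x, eval (-x) p = -eval x p) : u p = 0 := by
  have hneg : ∀ I : ℝ, I = -I → I = 0 := fun I h => by linarith
  rw [hu, hneg (∫ x in ballSet d, _), mul_zero]
  rw [← integral_indicator (measurableSet_ballSet d)]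
  conv_lhs => rw [← integral_neg_eq_self]
  rw [← integral_neg]
  congr 1
  ext x
  simp [Set.indicator_apply, ballSet, hp]
  split_ifs <;> simp

/-- The polynomial `x ↦ P_k^{(α,β)}(1 - 2‖x‖²)`. -/
noncomputable def radialJacobi (d : ℕ) (α β : ℝ) (k : ℕ) : MvPolynomial (Fin d) ℝ :=
  ∑ s ∈ Finset.range (k + 1), (genBinom (k + α) (k - s) * genBinom (k + β) s * (-1) ^ s) •
    (normSqPoly d ^ s * (1 - normSqPoly d) ^ (k - s))

lemma eval_radialJacobi {d : ℕ} (α β : ℝ) (k : ℕ) (x : Fin d → ℝ) :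
    eval x (radialJacobi d α β k) = jacobiP α β k (1 - 2 * ∑ i, x i ^ 2) := by
  simp [radialJacobi, jacobiP_one_sub_two_mul, smul_eval, eval_normSqPoly]

lemma totalDegree_radialJacobi_le (d : ℕ) (α β : ℝ) (k : ℕ) :
    (radialJacobi d α β k).totalDegree ≤ 2 * k := by
  refine totalDegree_finsetSum_le fun s hs => (totalDegree_smul_le _ _).trans ?_
  have hsk : s ≤ k := Nat.lt_succ_iff.mp (Finset.mem_range.mp hs)
  have h1 : (normSqPoly d ^ s).totalDegree ≤ s * 2 :=
    (totalDegree_pow _ _).trans (Nat.mul_le_mul_left s (totalDegree_normSqPoly_le d))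
  have h2 : (1 - normSqPoly d).totalDegree ≤ 2 :=
    (totalDegree_sub _ _).trans (by simpa using totalDegree_normSqPoly_le d)
  have h3 : ((1 - normSqPoly d) ^ (k - s)).totalDegree ≤ (k - s) * 2 :=
    (totalDegree_pow _ _).trans (Nat.mul_le_mul_left _ h2)
  have := totalDegree_mul (normSqPoly d ^ s) ((1 - normSqPoly d) ^ (k - s))
  omega

section BallFunctional

variable {d : ℕ} {μ : ℝ} {u : MvPolynomial (Fin d) ℝ →ₗ[ℝ] ℝ}

lemma IsBallFunctional.apply_radialJacobi_mul_of_even (hu : IsBallFunctional d μ u) (hd : d ≠ 0)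
    (hμ : -(1 / 2) < μ) {p : MvPolynomial (Fin d) ℝ} {m : ℕ} (hp : p.IsHomogeneous (2 * m))
    (k : ℕ) :
    u (radialJacobi d (d / 2) (μ - 1 / 2) k * p) = omegaMu d μ * halfSphereIntegral p *
      (poch (μ - 1 / 2 + 1) k / Nat.factorial k * poch (1 - m) k *
        (Real.Gamma ((d : ℝ) / 2 + m) * Real.Gamma (μ - 1 / 2 + 1) /
          Real.Gamma ((d : ℝ) / 2 + m + (μ - 1 / 2 + 1) + k))) := by
  rw [← sum_jacobi_coeff_mul_Gamma (by positivity) (by linarith), radialJacobi, Finset.sum_mul,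
    map_sum, Finset.mul_sum]
  refine Finset.sum_congr rfl fun s _ => ?_
  rw [smul_mul_assoc, map_smul, hu.apply_radial_mul_homogeneous hd hμ hp, smul_eq_mul]
  ring

lemma IsBallFunctional.apply_radialJacobi (hu : IsBallFunctional d μ u) (hd : d ≠ 0)
    (hμ : -(1 / 2) < μ) (k : ℕ) :
    poch (μ + ((d : ℝ) + 1) / 2) k / poch (μ + 1 / 2) k *
      u (radialJacobi d (d / 2) (μ - 1 / 2) k) = 1 := by
  have hd0 : (0 : ℝ) < d := by positivity
  have hb : 0 < μ + 1 / 2 := by linarith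
  have hc : 0 < μ + ((d : ℝ) + 1) / 2 := by linarith
  have h := hu.apply_radialJacobi_mul_of_even hd hμ (m := 0) (isHomogeneous_one _ _) k
  have e1 : μ - 1 / 2 + 1 = μ + 1 / 2 := by ring
  have e2 : (d : ℝ) / 2 + (μ + 1 / 2) + k = μ + ((d : ℝ) + 1) / 2 + k := by ring
  simp only [mul_one, Nat.cast_zero, add_zero, sub_zero, poch_one, halfSphereIntegral_one hd,
    e1, e2, Gamma_add_nat_eq_mul_poch hc, omegaMu] at h
  rw [h]
  have g1 := (Real.Gamma_pos_of_pos hb).ne'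
  have g2 := (Real.Gamma_pos_of_pos hc).ne'
  have g3 := (Real.Gamma_pos_of_pos (half_pos hd0)).ne'
  have p1 := (poch_pos hb k).ne'
  have p2 := (poch_pos hc k).ne'
  have p3 := (Real.rpow_pos_of_pos Real.pi_pos ((d : ℝ) / 2)).ne'
  have p4 : (Nat.factorial k : ℝ) ≠ 0 := by positivity
  generalize Real.Gamma (μ + 1 / 2) = G1 at *
  generalize Real.Gamma (μ + ((d : ℝ) + 1) / 2) = G2 at *
  generalize Real.Gamma ((d : ℝ) / 2) = G3 at *
  generalize poch (μ + 1 / 2) k = P1 at *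
  generalize poch (μ + ((d : ℝ) + 1) / 2) k = P2 at *
  generalize Real.pi ^ ((d : ℝ) / 2) = P3 at *
  field_simp

lemma IsBallFunctional.apply_kernel_mul_eq_eval_zero (hu : IsBallFunctional d μ u) (hd : d ≠ 0)
    (hμ : -(1 / 2) < μ) {n : ℕ} {p : MvPolynomial (Fin d) ℝ} (hp : p.totalDegree ≤ n) :
    u ((poch (μ + ((d : ℝ) + 1) / 2) (n / 2) / poch (μ + 1 / 2) (n / 2)) •
      radialJacobi d (d / 2) (μ - 1 / 2) (n / 2) * p) = eval 0 p := by
  rw [smul_mul_assoc, map_smul, smul_eq_mul]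
  have hcomp : ∀ i ∈ Finset.range p.totalDegree,
      u (radialJacobi d (d / 2) (μ - 1 / 2) (n / 2) * homogeneousComponent (i + 1) p) = 0 := by
    intro i hi
    have hin : i + 1 ≤ n := (Finset.mem_range.mp hi).trans_le hp
    have hhom := homogeneousComponent_isHomogeneous (i + 1) p
    rcases Nat.even_or_odd' (i + 1) with ⟨m, hm | hm⟩
    · rw [hm] at hhom
      rw [hm, hu.apply_radialJacobi_mul_of_even hd hμ hhom,
        poch_one_sub_eq_zero (by omega) (by omega)]
      ring
    · refine hu.apply_eq_zero_of_odd fun x => ?_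
      have hneg := IsHomogeneous_eval_smul hhom (-1) x
      rw [neg_one_smul, (show Odd (i + 1) from ⟨m, hm⟩).neg_one_pow] at hneg
      simp [eval_radialJacobi, hneg]
  conv_lhs => rw [← sum_homogeneousComponent p]
  rw [Finset.mul_sum, map_sum, Finset.sum_range_succ', Finset.sum_eq_zero hcomp, zero_add,
    homogeneousComponent_zero, mul_comm (radialJacobi _ _ _ _), ← smul_eq_C_mul, map_smul,
    smul_eq_mul, mul_left_comm, hu.apply_radialJacobi hd hμ, mul_one, ← constantCoeff_eq, eval_zero]

end BallFunctional

/-- Lemma 5.1. For `d ≥ 2`, `μ > -1/2` and `n ≥ 0`, the kernels of the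
classical ball moment functional `u_μ` satisfy
`K_n(u_μ;x,0) = ((μ+(d+1)/2)_{⌊n/2⌋}/(μ+1/2)_{⌊n/2⌋}) P_{⌊n/2⌋}^{(d/2,μ-1/2)}(1-2‖x‖²)`,
and `K_n(u_μ;0,0) = ((μ+(d+1)/2)_{⌊n/2⌋}/(μ+1/2)_{⌊n/2⌋}) C(⌊n/2⌋+d/2,⌊n/2⌋)`,
where `C(⌊n/2⌋+d/2,⌊n/2⌋) = (d/2+1)_{⌊n/2⌋}/⌊n/2⌋!`. -/
theorem ball_kernel_at_origin
    {d : ℕ} (hd : 2 ≤ d) {μ : ℝ} (hμ : -(1 / 2) < μ)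
    (u : MvPolynomial (Fin d) ℝ →ₗ[ℝ] ℝ) (hu : IsBallFunctional d μ u)
    (P : PolySystem d) (hP : IsOPS u P) :
    (∀ (n : ℕ) (x : Fin d → ℝ),
      kerLT u P (n + 1) x 0 =
        (poch (μ + ((d : ℝ) + 1) / 2) (n / 2) / poch (μ + 1 / 2) (n / 2)) *
          jacobiP ((d : ℝ) / 2) (μ - 1 / 2) (n / 2) (1 - 2 * ∑ i, x i ^ 2)) ∧
    (∀ n : ℕ,
      kerLT u P (n + 1) 0 0 =
        (poch (μ + ((d : ℝ) + 1) / 2) (n / 2) / poch (μ + 1 / 2) (n / 2)) *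
          (poch ((d : ℝ) / 2 + 1) (n / 2) / (Nat.factorial (n / 2) : ℝ))) := by
  have hd0 : d ≠ 0 := by omega
  have hker : ∀ (n : ℕ) (x : Fin d → ℝ),
      kerLT u P (n + 1) x 0 =
        (poch (μ + ((d : ℝ) + 1) / 2) (n / 2) / poch (μ + 1 / 2) (n / 2)) *
          jacobiP ((d : ℝ) / 2) (μ - 1 / 2) (n / 2) (1 - 2 * ∑ i, x i ^ 2) := by
    intro n x
    rw [hP.kerLT_eq_eval
      (((totalDegree_smul_le _ _).trans (totalDegree_radialJacobi_le _ _ _ _)).trans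
        (Nat.mul_div_le n 2))
      (fun p hp => hu.apply_kernel_mul_eq_eval_zero hd0 hμ hp) x, smul_eval, eval_radialJacobi]
  refine ⟨hker, fun n => ?_⟩
  rw [hker n 0]
  simp [jacobiP_one]
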